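/- Let n = |𝓛| and assume T(𝓛) acts transitively on 𝓛. Suppose T(𝓛) contains a nontrivial cycle γ whose length (the number of points it moves) is at most n − 1. Then the action of T(𝓛) on 𝓛 is primitive. -/

import Mathlib

open scoped symmDiff

namespace TogglePaper

variable {E : Type*} [DecidableEq E]

/-- The toggle `τ_e` on the collection `L` of subsets of the ground set. -/
def toggle (L : Finset (Finset E)) (e : E) : Equiv.Perm {A : Finset E // A ∈ L} :=
  Function.Involutive.toPerm
    (fun X => if h : X.1 ∆ ({e} : Finset E) ∈ L then ⟨X.1 ∆ ({e} : Finset E), h⟩ else X)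
    (by
      intro X
      by_cases h : X.1 ∆ ({e} : Finset E) ∈ L
      · have h2 : (X.1 ∆ ({e} : Finset E)) ∆ ({e} : Finset E) = X.1 :=
          symmDiff_symmDiff_cancel_right _ _
        simp only [dif_pos h, h2]
        simp [h2, X.2]
      · simp [h])

/-- The generalized toggle group `T(L)`. -/
def toggleGroup (L : Finset (Finset E)) : Subgroup (Equiv.Perm {A : Finset E // A ∈ L}) :=
  Subgroup.closure (Set.range (toggle L))

/-- `T(L)` acts transitively on `L`. -/
def IsTransitive (L : Finset (Finset E)) : Prop :=
  ∀ A B : {A : Finset E // A ∈ L}, ∃ g ∈ toggleGroup L, g A = B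

/-- `B` is a block for the action of `T(L)` on `L`. -/
def IsBlock (L : Finset (Finset E)) (B : Finset {A : Finset E // A ∈ L}) : Prop :=
  ∀ g ∈ toggleGroup L, Finset.image g B = B ∨ Disjoint (Finset.image g B) B

/-- `Blocks` is a block system for `T(L)`: a partition of `L` into nonempty blocks
that is permuted by every element of `T(L)`. -/
def IsBlockSystem (L : Finset (Finset E))
    (Blocks : Finset (Finset {A : Finset E // A ∈ L})) : Prop :=
  (∀ B ∈ Blocks, B.Nonempty) ∧
  (∀ A : {A : Finset E // A ∈ L}, ∃! B : Finset {A : Finset E // A ∈ L},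
      B ∈ Blocks ∧ A ∈ B) ∧
  (∀ g ∈ toggleGroup L, ∀ B ∈ Blocks, Finset.image g B ∈ Blocks)

/-- An element `g` of `T(L)` is type 2 (with respect to a fixed block system `Blocks`)
if it maps each block to itself; it is type 1 otherwise. -/
def IsType2 (L : Finset (Finset E)) (Blocks : Finset (Finset {A : Finset E // A ∈ L}))
    (g : Equiv.Perm {A : Finset E // A ∈ L}) : Prop :=
  ∀ B ∈ Blocks, Finset.image g B = B

/-- The action of `T(L)` on `L` is primitive: it is transitive and the only blocks
are the singletons, the empty set and the whole set. -/
def IsPrimitive (L : Finset (Finset E)) : Prop :=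
  IsTransitive L ∧
    ∀ B : Finset {A : Finset E // A ∈ L}, IsBlock L B → B.card ≤ 1 ∨ B = Finset.univ

/-- `T(L)` contains a long cycle, i.e. a cycle whose support is all of `L`. -/
def HasLongCycle (L : Finset (Finset E)) : Prop :=
  ∃ g ∈ toggleGroup L, g.IsCycle ∧ g.support = Finset.univ

section Toggles

variable {L : Finset (Finset E)}

theorem toggle_val_of_mem {e : E} {X : {A : Finset E // A ∈ L}}
    (h : X.1 ∆ ({e} : Finset E) ∈ L) : (toggle L e X).1 = X.1 ∆ ({e} : Finset E) :=
  congrArg Subtype.val (dif_pos h)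

theorem toggle_eq_self {e : E} {X : {A : Finset E // A ∈ L}}
    (h : X.1 ∆ ({e} : Finset E) ∉ L) : toggle L e X = X :=
  dif_neg h

theorem toggle_val_of_ne {e : E} {X : {A : Finset E // A ∈ L}} (h : toggle L e X ≠ X) :
    (toggle L e X).1 = X.1 ∆ ({e} : Finset E) :=
  toggle_val_of_mem (by_contra fun h' => h (toggle_eq_self h'))

theorem toggle_toggle (e : E) (X : {A : Finset E // A ∈ L}) :
    toggle L e (toggle L e X) = X :=
  (toggle L e).left_inv X

theorem mem_toggle_iff {e x : E} (hx : x ≠ e) (X : {A : Finset E // A ∈ L}) :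
    x ∈ (toggle L e X).1 ↔ x ∈ X.1 := by
  by_cases h : X.1 ∆ ({e} : Finset E) ∈ L
  · rw [toggle_val_of_mem h]
    simp [Finset.mem_symmDiff, hx]
  · rw [toggle_eq_self h]

theorem toggle_mem (L : Finset (Finset E)) (e : E) : toggle L e ∈ toggleGroup L :=
  Subgroup.subset_closure ⟨e, rfl⟩

/-- A property preserved by toggles and true at one point holds everywhere, by transitivity. -/
theorem IsTransitive.induction (htrans : IsTransitive L) {P : {A : Finset E // A ∈ L} → Prop}
    (hstep : ∀ e X, P X → P (toggle L e X)) {X : {A : Finset E // A ∈ L}} (hX : P X)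
    (Y : {A : Finset E // A ∈ L}) : P Y := by
  have key : ∀ g ∈ toggleGroup L, ∀ X, P X ↔ P (g X) := by
    intro g hg
    induction hg using Subgroup.closure_induction with
    | mem g hg =>
      obtain ⟨e, rfl⟩ := hg
      intro X
      refine ⟨hstep e X, fun h => ?_⟩
      simpa only [toggle_toggle] using hstep e _ h
    | one => simp
    | mul g h _ _ hg hh => intro X; rw [hh X, hg (h X)]; rfl
    | inv g _ hg => intro X; rw [hg (g⁻¹ X)]; simp
  obtain ⟨g, hg, rfl⟩ := htrans X Y
  exact (key g hg X).1 hX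

/-! ### Splitting the ground set into two commuting parts -/

/-- The subgroup generated by the toggles at elements of `I`. -/
def partialToggleGroup (L : Finset (Finset E)) (I : Set E) :
    Subgroup (Equiv.Perm {A : Finset E // A ∈ L}) :=
  Subgroup.closure (toggle L '' I)

theorem mem_apply_iff_of_notMem {I : Set E} {g : Equiv.Perm {A : Finset E // A ∈ L}}
    (hg : g ∈ partialToggleGroup L I) {x : E} (hx : x ∉ I) (X : {A : Finset E // A ∈ L}) :
    x ∈ (g X).1 ↔ x ∈ X.1 := by
  induction hg using Subgroup.closure_induction generalizing X with
  | mem g hg =>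
    obtain ⟨e, he, rfl⟩ := hg
    exact mem_toggle_iff (ne_of_mem_of_not_mem he hx).symm X
  | one => rfl
  | mul g h _ _ hg hh => exact (hg (h X)).trans (hh X)
  | inv g _ hg => rw [← hg (g⁻¹ X)]; simp

/-- Elements of complementary partial toggle groups agree at a point only by fixing it. -/
theorem apply_eq_self_of_apply_eq {I : Set E} {p q : Equiv.Perm {A : Finset E // A ∈ L}}
    (hp : p ∈ partialToggleGroup L I) (hq : q ∈ partialToggleGroup L Iᶜ)
    {X : {A : Finset E // A ∈ L}} (h : p X = q X) : p X = X := by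
  refine Subtype.ext (Finset.ext fun x => ?_)
  by_cases hx : x ∈ I
  · rw [h]
    exact mem_apply_iff_of_notMem hq (fun h => h hx) X
  · exact mem_apply_iff_of_notMem hp hx X

theorem partialToggleGroup_commute {I : Set E}
    (hI : ∀ e ∈ I, ∀ f ∉ I, Commute (toggle L e) (toggle L f))
    {p q : Equiv.Perm {A : Finset E // A ∈ L}}
    (hp : p ∈ partialToggleGroup L I) (hq : q ∈ partialToggleGroup L Iᶜ) : Commute p q := by
  induction hp using Subgroup.closure_induction with
  | mem p hp =>
    obtain ⟨e, he, rfl⟩ := hp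
    induction hq using Subgroup.closure_induction with
    | mem q hq =>
      obtain ⟨f, hf, rfl⟩ := hq
      exact hI e he f hf
    | one => exact Commute.one_right _
    | mul _ _ _ _ h₁ h₂ => exact h₁.mul_right h₂
    | inv _ _ h => exact h.inv_right
  | one => exact Commute.one_left _
  | mul _ _ _ _ h₁ h₂ => exact h₁.mul_left h₂
  | inv _ _ h => exact h.inv_left

theorem exists_mul_of_mem_toggleGroup {I : Set E}
    (hI : ∀ e ∈ I, ∀ f ∉ I, Commute (toggle L e) (toggle L f))
    {g : Equiv.Perm {A : Finset E // A ∈ L}} (hg : g ∈ toggleGroup L) :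
    ∃ p ∈ partialToggleGroup L I, ∃ q ∈ partialToggleGroup L Iᶜ, g = p * q := by
  induction hg using Subgroup.closure_induction with
  | mem g hg =>
    obtain ⟨e, rfl⟩ := hg
    by_cases he : e ∈ I
    · exact ⟨_, Subgroup.subset_closure ⟨e, he, rfl⟩, 1, one_mem _, (mul_one _).symm⟩
    · exact ⟨1, one_mem _, _, Subgroup.subset_closure ⟨e, he, rfl⟩, (one_mul _).symm⟩
  | one => exact ⟨1, one_mem _, 1, one_mem _, (mul_one _).symm⟩
  | mul _ _ _ _ h₁ h₂ =>
    obtain ⟨p, hp, q, hq, rfl⟩ := h₁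
    obtain ⟨p', hp', q', hq', rfl⟩ := h₂
    exact ⟨p * p', mul_mem hp hp', q * q', mul_mem hq hq',
      ((partialToggleGroup_commute hI hp' hq).symm.mul_mul_mul_comm p q')⟩
  | inv _ _ h =>
    obtain ⟨p, hp, q, hq, rfl⟩ := h
    exact ⟨p⁻¹, inv_mem hp, q⁻¹, inv_mem hq, by
      rw [(partialToggleGroup_commute hI hp hq).eq, mul_inv_rev]⟩

/-- If the ground set splits into two nonempty commuting parts, no cycle is supported by one
part only. -/
theorem not_isCycle_of_mem_partialToggleGroup {I : Set E} (hnt : ∀ e : E, toggle L e ≠ 1)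
    (htrans : IsTransitive L)
    (hI : ∀ e ∈ I, ∀ f ∉ I, Commute (toggle L e) (toggle L f)) (hne : Iᶜ.Nonempty)
    {γ : Equiv.Perm {A : Finset E // A ∈ L}} (hγ : γ ∈ partialToggleGroup L I) :
    ¬ γ.IsCycle := by
  intro hcyc
  obtain ⟨f₀, hf₀⟩ := hne
  obtain ⟨Y, hY, hYcyc⟩ := hcyc
  have htog : ∀ f ∉ I, toggle L f Y = Y := by
    intro f hf
    have hmem : toggle L f ∈ partialToggleGroup L Iᶜ := Subgroup.subset_closure ⟨f, hf, rfl⟩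
    have hcomm := partialToggleGroup_commute hI hγ hmem
    have hmove : γ (toggle L f Y) ≠ toggle L f Y := by
      intro h
      have h' : γ (toggle L f Y) = toggle L f (γ Y) := congrArg (· Y) hcomm.eq
      exact hY ((toggle L f).injective (h'.symm.trans h))
    obtain ⟨k, hk⟩ := hYcyc hmove
    rw [← hk]
    exact apply_eq_self_of_apply_eq (zpow_mem hγ k) hmem hk
  refine hnt f₀ (Equiv.ext fun X => ?_)
  refine htrans.induction (P := fun X => ∀ f ∉ I, toggle L f X = X) ?_ htog X f₀ hf₀
  intro e X hX f hf
  by_cases he : e ∈ I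
  · have h' : toggle L e (toggle L f X) = toggle L f (toggle L e X) :=
      congrArg (· X) (hI e he f hf).eq
    rw [← h', hX f hf]
  · rw [hX e he, hX f hf]

/-- If the ground set splits into two nonempty commuting parts, a transitive toggle group
contains no cycle with a fixed point. -/
theorem not_isCycle_of_commute {I : Set E} (hnt : ∀ e : E, toggle L e ≠ 1)
    (htrans : IsTransitive L)
    (hI : ∀ e ∈ I, ∀ f ∉ I, Commute (toggle L e) (toggle L f))
    (hne : I.Nonempty) (hne' : Iᶜ.Nonempty)
    {γ : Equiv.Perm {A : Finset E // A ∈ L}} (hγ : γ ∈ toggleGroup L)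
    {Z : {A : Finset E // A ∈ L}} (hZ : γ Z = Z) : ¬ γ.IsCycle := by
  intro hcyc
  have hI' : ∀ e ∈ Iᶜ, ∀ f ∉ Iᶜ, Commute (toggle L e) (toggle L f) :=
    fun e he f hf => (hI f (not_not.1 hf) e he).symm
  obtain ⟨p, hp, q, hq, rfl⟩ := exists_mul_of_mem_toggleGroup hI hγ
  have hpq := partialToggleGroup_commute hI hp hq
  have hfixp : ∀ {X}, (p * q) X = X → p X = X := by
    intro X h
    have h' : p X = q⁻¹ X := by
      rw [Equiv.Perm.eq_inv_iff_eq]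
      exact (congrArg (· X) hpq.eq).symm.trans h
    exact apply_eq_self_of_apply_eq hp (inv_mem hq) h'
  have hfixq : ∀ {X}, (p * q) X = X → q X = X := fun {X} h => by
    have h' : q (p X) = X := (congrArg (· X) hpq.eq).symm.trans h
    rwa [hfixp h] at h'
  have hfull : ∀ {r : Equiv.Perm {A : Finset E // A ∈ L}}, Commute r (p * q) →
      (∀ {X}, (p * q) X = X → r X = X) → r ≠ 1 → ∀ {X}, r X = X → (p * q) X = X := by
    intro r hr hfix hne X hX
    by_contra hmove
    refine hne (Equiv.ext fun W => ?_)
    by_cases hW : (p * q) W = W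
    · exact hfix hW
    · obtain ⟨k, rfl⟩ := hcyc.exists_zpow_eq hmove hW
      have h' : r (((p * q) ^ k) X) = ((p * q) ^ k) (r X) :=
        congrArg (· X) (hr.zpow_right k).eq
      rw [h', hX]
      rfl
  by_cases hp1 : p = 1
  · refine not_isCycle_of_mem_partialToggleGroup hnt htrans hI' (by simpa using hne) hq ?_
    simpa [hp1] using hcyc
  by_cases hq1 : q = 1
  · refine not_isCycle_of_mem_partialToggleGroup hnt htrans hI hne' hp ?_
    simpa [hq1] using hcyc
  have hp2 := @hfull p ((Commute.refl p).mul_right hpq) hfixp hp1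
  have hq2 := @hfull q (hpq.symm.mul_right (Commute.refl q)) hfixq hq1
  refine hcyc.ne_one (Equiv.ext fun X => ?_)
  refine htrans.induction (P := fun X => (p * q) X = X) ?_ hZ X
  intro e X hX
  by_cases he : e ∈ I
  · apply hq2
    have h' : toggle L e (q X) = q (toggle L e X) := congrArg (· X)
      (partialToggleGroup_commute hI (Subgroup.subset_closure ⟨e, he, rfl⟩) hq).eq
    rw [← h', hfixq hX]
  · apply hp2
    have h' : p (toggle L e X) = toggle L e (p X) := congrArg (· X)
      (partialToggleGroup_commute hI hp (Subgroup.subset_closure ⟨e, he, rfl⟩)).eq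
    rw [h', hfixp hX]

/-! ### Toggles and invariant equivalence relations -/

/-- A toggle is internal if it moves some point within its equivalence class. -/
def IsInternal (L : Finset (Finset E)) (s : Setoid {A : Finset E // A ∈ L}) (e : E) : Prop :=
  ∃ X, toggle L e X ≠ X ∧ s X (toggle L e X)

/-- An equivalence relation preserved by all toggles. -/
def IsInvariant (L : Finset (Finset E)) (s : Setoid {A : Finset E // A ∈ L}) : Prop :=
  ∀ e X Y, s X Y → s (toggle L e X) (toggle L e Y)

variable {s : Setoid {A : Finset E // A ∈ L}}

theorem IsInvariant.rel_toggle (hs : IsInvariant L s) {e : E} {X Y : {A : Finset E // A ∈ L}}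
    (h : s X Y) (hY : s Y (toggle L e Y)) : s X (toggle L e X) :=
  s.trans (s.trans h hY) (hs e _ _ (s.symm h))

theorem ne_of_not_rel {e : E} {X : {A : Finset E // A ∈ L}} (h : ¬ s X (toggle L e X)) :
    toggle L e X ≠ X :=
  fun h' => h (h'.symm ▸ s.refl X)

theorem IsInvariant.toggle_comm_of_ne (hs : IsInvariant L s) {e f : E}
    {X : {A : Finset E // A ∈ L}} (hf : ¬ s X (toggle L f X)) (he : s X (toggle L e X))
    (hne : toggle L e X ≠ X) : toggle L e (toggle L f X) = toggle L f (toggle L e X) := by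
  have h₁ := toggle_val_of_ne (ne_of_not_rel hf)
  have h₂ := toggle_val_of_ne hne
  have h₃ := toggle_val_of_ne (ne_of_not_rel fun h => hf (hs.rel_toggle he h))
  have h₄ : (toggle L f (toggle L e X)).1 = (toggle L f X).1 ∆ ({e} : Finset E) := by
    rw [h₃, h₁, h₂, symmDiff_right_comm]
  refine Subtype.ext ?_
  rw [h₄]
  exact toggle_val_of_mem (h₄ ▸ (toggle L f (toggle L e X)).2)

theorem IsInternal.rel_toggle (htrans : IsTransitive L) (hs : IsInvariant L s) {e : E}
    (he : IsInternal L s e) (Y : {A : Finset E // A ∈ L}) : s Y (toggle L e Y) := by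
  obtain ⟨X₀, hne₀, hX₀⟩ := he
  obtain ⟨X, hYX, hX, -⟩ := htrans.induction
    (P := fun Y => ∃ X, s Y X ∧ s X (toggle L e X) ∧ toggle L e X ≠ X) (by
      rintro f Y ⟨X, hYX, hX, hne⟩
      by_cases hf : s X (toggle L f X)
      · exact ⟨X, s.trans (s.symm (hs.rel_toggle hYX hf)) hYX, hX, hne⟩
      · refine ⟨toggle L f X, hs f _ _ hYX, ?_, ?_⟩
        · rw [hs.toggle_comm_of_ne hf hX hne]
          exact hs f _ _ hX
        · rw [hs.toggle_comm_of_ne hf hX hne]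
          exact fun h => hne ((toggle L f).injective h))
    (X := X₀) ⟨X₀, s.refl X₀, hX₀, hne₀⟩ Y
  exact hs.rel_toggle hYX hX

theorem toggle_eq_self_of_not_isInternal {f : E} (hf : ¬ IsInternal L s f)
    {X : {A : Finset E // A ∈ L}} (h : s X (toggle L f X)) : toggle L f X = X :=
  by_contra fun hne => hf ⟨X, hne, h⟩

theorem IsInternal.commute (htrans : IsTransitive L) (hs : IsInvariant L s) {e f : E}
    (he : IsInternal L s e) (hf : ¬ IsInternal L s f) :
    Commute (toggle L e) (toggle L f) := by
  have hrel := he.rel_toggle htrans hs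
  refine Equiv.ext fun X => ?_
  change toggle L e (toggle L f X) = toggle L f (toggle L e X)
  by_cases hX : s X (toggle L f X)
  · rw [toggle_eq_self_of_not_isInternal hf hX, toggle_eq_self_of_not_isInternal hf
      (hs.rel_toggle (s.symm (hrel X)) hX)]
  · by_cases hne : toggle L e X = X
    · rw [hne]
      by_contra hne'
      have hY : ¬ s (toggle L f X) (toggle L f (toggle L f X)) := by
        rw [toggle_toggle]
        exact fun h => hX (s.symm h)
      have h := hs.toggle_comm_of_ne hY (hrel _) hne'
      rw [toggle_toggle, hne] at h
      apply hne'
      rw [← toggle_toggle f (toggle L e (toggle L f X)), ← h]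
    · exact hs.toggle_comm_of_ne hX (hrel X) hne

/-! ### The case without internal toggles -/

/-- A toggle commuting with a translation `σ` by a set other than `{f}` is even. -/
theorem sign_toggle_eq_one {f x : E} (hx : x ≠ f) {σ : Equiv.Perm {A : Finset E // A ∈ L}}
    (hσ : Commute σ (toggle L f)) (hσx : ∀ X, x ∈ (σ X).1 ↔ x ∉ X.1) :
    Equiv.Perm.sign (toggle L f) = 1 := by
  have hmem : ∀ X : {A : Finset E // A ∈ L}, x ∈ (toggle L f X).1 ↔ x ∈ X.1 := mem_toggle_iff hx
  set a : Equiv.Perm {A : Finset E // A ∈ L} :=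
    Equiv.Perm.ofSubtype ((toggle L f).subtypePerm (p := fun X => x ∈ X.1) hmem)
  have ha₁ : ∀ X, x ∈ X.1 → a X = toggle L f X := by
    intro X hX
    exact Equiv.Perm.ofSubtype_apply_of_mem ((toggle L f).subtypePerm hmem) hX
  have ha₂ : ∀ X, x ∉ X.1 → a X = X := by
    intro X hX
    exact Equiv.Perm.ofSubtype_apply_of_not_mem ((toggle L f).subtypePerm hmem) hX
  have hinv : ∀ X, x ∈ (σ⁻¹ X).1 ↔ x ∉ X.1 := by
    intro X
    have h := hσx (σ⁻¹ X)
    rw [Equiv.Perm.coe_inv, Equiv.apply_symm_apply] at h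
    tauto
  have hfac : toggle L f = a * (σ * a * σ⁻¹) := by
    refine Equiv.ext fun X => ?_
    simp only [Equiv.Perm.mul_apply]
    by_cases hX : x ∈ X.1
    · rw [ha₂ (σ⁻¹ X) (by rw [hinv]; exact not_not.2 hX), Equiv.Perm.coe_inv, Equiv.apply_symm_apply, ha₁ X hX]
    · rw [ha₁ (σ⁻¹ X) ((hinv X).2 hX)]
      have h : σ (toggle L f (σ⁻¹ X)) = toggle L f X := by
        have := congrArg (· (σ⁻¹ X)) hσ.eq
        simpa using this
      rw [h, ha₂ _ (by rwa [hmem])]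
  rw [hfac]
  simp only [map_mul, map_inv]
  rw [mul_right_comm (Equiv.Perm.sign σ), mul_inv_cancel, one_mul, Int.units_mul_self]

theorem even_card_support_of_commute {α : Type*} [Fintype α] [DecidableEq α]
    {σ γ : Equiv.Perm α} (hσ : Function.Involutive σ) (hfree : ∀ X, σ X ≠ X)
    (hcomm : Commute σ γ) : Even γ.support.card := by
  have h : ∑ _X ∈ γ.support, (1 : ZMod 2) = 0 := by
    refine Finset.sum_involution (fun X _ => σ X) (fun _ _ => by decide)
      (fun X _ _ => hfree X) (fun X hX => ?_) (fun X _ => hσ X)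
    rw [Equiv.Perm.mem_support] at hX ⊢
    intro h
    have h' : σ (γ X) = γ (σ X) := congrArg (· X) hcomm.eq
    exact hX (σ.injective (h'.trans h))
  rw [Finset.sum_const, nsmul_one] at h
  exact even_iff_two_dvd.2 ((ZMod.natCast_eq_zero_iff _ _).1 h)

theorem not_isCycle_of_forall_not_isInternal (htrans : IsTransitive L) (hs : IsInvariant L s)
    (hint : ∀ e, ¬ IsInternal L s e) {X₀ X₁ : {A : Finset E // A ∈ L}} (hne : X₀ ≠ X₁)
    (hrel : s X₀ X₁) {γ : Equiv.Perm {A : Finset E // A ∈ L}} (hγ : γ ∈ toggleGroup L) :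
    ¬ γ.IsCycle := by
  intro hcyc
  set v : Finset E := X₀.1 ∆ X₁.1 with hv
  have hvne : v.Nonempty := by
    rw [Finset.nonempty_iff_ne_empty]
    intro h
    exact hne (Subtype.ext (symmDiff_eq_bot.1 h))
  have htog : ∀ f X Y, s X Y → Y.1 = X.1 ∆ v → (toggle L f Y).1 = (toggle L f X).1 ∆ v := by
    intro f X Y hXY h
    by_cases hf : s X (toggle L f X)
    · rw [toggle_eq_self_of_not_isInternal (hint f) hf, toggle_eq_self_of_not_isInternal (hint f)
        (hs.rel_toggle (s.symm hXY) hf), h]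
    · rw [toggle_val_of_ne (ne_of_not_rel hf),
        toggle_val_of_ne (ne_of_not_rel fun h => hf (hs.rel_toggle hXY h)), h, symmDiff_right_comm]
  have hex : ∀ X : {A : Finset E // A ∈ L}, ∃ Y, s X Y ∧ Y.1 = X.1 ∆ v := by
    refine htrans.induction ?_ (X := X₀) ⟨X₁, hrel, by rw [hv, symmDiff_symmDiff_cancel_left]⟩
    rintro f X ⟨Y, hXY, h⟩
    exact ⟨toggle L f Y, hs f _ _ hXY, htog f X Y hXY h⟩
  choose t ht₁ ht₂ using hex
  have hinvol : Function.Involutive t := fun X => Subtype.ext (by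
    rw [ht₂, ht₂, symmDiff_symmDiff_cancel_right])
  set σ : Equiv.Perm {A : Finset E // A ∈ L} := hinvol.toPerm
  have hσt : ∀ X, σ X = t X := fun X => rfl
  have hcomm : ∀ f, Commute σ (toggle L f) := fun f => Equiv.ext fun X => Subtype.ext (by
    change (t (toggle L f X)).1 = (toggle L f (t X)).1
    rw [htog f X (t X) (ht₁ X) (ht₂ X), ht₂])
  have hmem : ∀ x ∈ v, ∀ X, x ∈ (σ X).1 ↔ x ∉ X.1 := by
    intro x hx X
    rw [hσt, ht₂, Finset.mem_symmDiff]
    tauto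
  have hsign : ∀ f, Equiv.Perm.sign (toggle L f) = 1 := by
    intro f
    obtain ⟨x, hx, hxf⟩ : ∃ x ∈ v, x ≠ f := by
      by_contra! h
      have hvf : v = {f} := Finset.eq_singleton_iff_nonempty_unique_mem.2 ⟨hvne, h⟩
      have h₀ : X₀.1 ∆ ({f} : Finset E) = X₁.1 := by
        rw [← hvf, hv, symmDiff_symmDiff_cancel_left]
      have h₁ : toggle L f X₀ = X₁ :=
        Subtype.ext ((toggle_val_of_mem (h₀ ▸ X₁.2)).trans h₀)
      exact hint f ⟨X₀, h₁ ▸ hne.symm, h₁ ▸ hrel⟩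
    exact sign_toggle_eq_one hxf (hcomm f) (hmem x hx)
  have hγ' : Commute σ γ ∧ Equiv.Perm.sign γ = 1 := by
    clear hcyc
    induction hγ using Subgroup.closure_induction with
    | mem g hg =>
      obtain ⟨f, rfl⟩ := hg
      exact ⟨hcomm f, hsign f⟩
    | one => exact ⟨Commute.one_right _, map_one _⟩
    | mul g h _ _ hg hh => exact ⟨hg.1.mul_right hh.1, by rw [map_mul, hg.2, hh.2, one_mul]⟩
    | inv g _ hg => exact ⟨hg.1.inv_right, by rw [map_inv, hg.2, inv_one]⟩
  have heven : Even γ.support.card := by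
    refine even_card_support_of_commute hinvol (fun X hX => ?_) hγ'.1
    obtain ⟨x, hx⟩ := hvne
    have := hmem x hx X
    rw [hX] at this
    tauto
  have := hcyc.sign
  rw [hγ'.2, heven.neg_one_pow] at this
  exact absurd this (by decide)

/-! ### The equivalence relation of a block -/

theorem IsBlock.mem_of_mem {B : Finset {A : Finset E // A ∈ L}} (hB : IsBlock L B)
    {g : Equiv.Perm {A : Finset E // A ∈ L}} (hg : g ∈ toggleGroup L)
    {X Y : {A : Finset E // A ∈ L}} (hX : X ∈ B) (hgX : g X ∈ B) (hY : Y ∈ B) : g Y ∈ B := by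
  rcases hB g hg with h | h
  · exact h ▸ Finset.mem_image_of_mem g hY
  · exact absurd hgX (Finset.disjoint_left.1 h (Finset.mem_image_of_mem g hX))

/-- Two points are related if they lie in a common translate of the block. -/
def IsBlock.setoid {B : Finset {A : Finset E // A ∈ L}} (hB : IsBlock L B)
    (htrans : IsTransitive L) (hne : B.Nonempty) : Setoid {A : Finset E // A ∈ L} where
  r X Y := ∃ g ∈ toggleGroup L, g X ∈ B ∧ g Y ∈ B
  iseqv := by
    refine ⟨fun X => ?_, fun ⟨g, hg, hX, hY⟩ => ⟨g, hg, hY, hX⟩, ?_⟩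
    · obtain ⟨Z, hZ⟩ := hne
      obtain ⟨g, hg, rfl⟩ := htrans X Z
      exact ⟨g, hg, hZ, hZ⟩
    · rintro X Y Z ⟨g, hg, hX, hY⟩ ⟨h, hh, hY', hZ⟩
      refine ⟨h, hh, ?_, hZ⟩
      simpa using hB.mem_of_mem (mul_mem hh (inv_mem hg)) hY (by simpa using hY') hX

theorem IsBlock.setoid_isInvariant {B : Finset {A : Finset E // A ∈ L}} (hB : IsBlock L B)
    (htrans : IsTransitive L) (hne : B.Nonempty) : IsInvariant L (hB.setoid htrans hne) := by
  rintro e X Y ⟨g, hg, hX, hY⟩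
  exact ⟨g * toggle L e, mul_mem hg (toggle_mem L e), by simpa [toggle_toggle] using hX,
    by simpa [toggle_toggle] using hY⟩

theorem IsBlock.eq_univ_of_forall_rel {B : Finset {A : Finset E // A ∈ L}} (hB : IsBlock L B)
    (htrans : IsTransitive L) (hne : B.Nonempty)
    (h : ∀ e X, hB.setoid htrans hne X (toggle L e X)) : B = Finset.univ := by
  obtain ⟨X, hX⟩ := id hne
  refine Finset.eq_univ_iff_forall.2 fun Y => ?_
  obtain ⟨g, hg, hgX, hgY⟩ := htrans.induction (P := hB.setoid htrans hne X)
    (fun e Y hY => (hB.setoid htrans hne).trans hY (h e Y)) ((hB.setoid htrans hne).refl X) Y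
  simpa using hB.mem_of_mem (inv_mem hg) hgX (by simpa using hX) hgY

end Toggles

/-- a transitive toggle group containing a nontrivial cycle of length
at most `n - 1` is primitive. -/
theorem transitive_with_short_cycle_is_primitive
    [Fintype E] (L : Finset (Finset E))
    (hnt : ∀ e : E, toggle L e ≠ 1)
    (htrans : IsTransitive L)
    (γ : Equiv.Perm {A : Finset E // A ∈ L}) (hγ : γ ∈ toggleGroup L)
    (hcyc : γ.IsCycle) (hshort : γ.support.card < L.card) :
    IsPrimitive L := by
  refine ⟨htrans, fun B hB => ?_⟩
  by_contra! hcon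
  obtain ⟨hcard, huniv⟩ := hcon
  obtain ⟨X₀, hX₀, X₁, hX₁, hne⟩ := Finset.one_lt_card.1 hcard
  have hBne : B.Nonempty := ⟨X₀, hX₀⟩
  have hs := hB.setoid_isInvariant htrans hBne
  by_cases hint : ∃ e, IsInternal L (hB.setoid htrans hBne) e
  · obtain ⟨f, hf⟩ : ∃ f, ¬ IsInternal L (hB.setoid htrans hBne) f := by
      by_contra! hall
      exact huniv (hB.eq_univ_of_forall_rel htrans hBne fun e => (hall e).rel_toggle htrans hs)
    obtain ⟨Z, hZ⟩ : ∃ Z, γ Z = Z := by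
      by_contra! hmove
      have hsupp : γ.support = Finset.univ :=
        Finset.eq_univ_iff_forall.2 fun Z => Equiv.Perm.mem_support.2 (hmove Z)
      rw [hsupp, Finset.card_univ, Fintype.card_coe] at hshort
      exact lt_irrefl _ hshort
    exact not_isCycle_of_commute (I := {e | IsInternal L (hB.setoid htrans hBne) e}) hnt htrans
      (fun e he f hf => IsInternal.commute htrans hs he hf) hint ⟨f, hf⟩ hγ hZ hcyc
  · exact not_isCycle_of_forall_not_isInternal htrans hs (not_exists.1 hint) hne
      ⟨1, one_mem _, hX₀, hX₁⟩ hγ hcyc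

end TogglePaper
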